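/- arXiv:2412.21134 — 2 statements merged into one kernel-verified Lean document; each statement's English description precedes it below -/
import Mathlib

section
/- Let G = (V, E) be an undirected graph and define the directed graph G⃗ as follows: V(G⃗) = V ∪ {w_e, w'_e : e ∈ E}, and for each edge e = {u, v} ∈ E, G⃗ contains the five directed edges (u, w_e), (v, w_e), (w_e, w'_e), (w'_e, u), (w'_e, v). Then for any s, t ∈ V there is a bijection between (simple) s-t-paths in G and (simple) directed s-t-paths in G⃗, under which an undirected path using edges e₁, …, e_m corresponds to the directed path using the middle edges (w_{e₁}, w'_{e₁}), …, (w_{e_m}, w'_{e_m}) together with the appropriate connector edges. -/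
namespace Stmt15

/-- Vertices of the directed gadget graph: the original vertices, plus for each
undirected edge `e` the two gadget vertices `w_e = (e, false)` and `w'_e = (e, true)`. -/
abbrev DV (V : Type*) (G : SimpleGraph V) := V ⊕ (G.edgeSet × Bool)

/-- The adjacency of the directed gadget graph: for each edge `e = {u,v}` of `G` the
five directed edges `(u,w_e)`, `(v,w_e)`, `(w_e,w'_e)`, `(w'_e,u)`, `(w'_e,v)`. -/
def A {V : Type*} (G : SimpleGraph V) : DV V G → DV V G → Prop := fun x y =>
  match x, y with
  | Sum.inl u, Sum.inr (e, b) => b = false ∧ u ∈ (e : Sym2 V)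
  | Sum.inr (e, b), Sum.inl u => b = true ∧ u ∈ (e : Sym2 V)
  | Sum.inr (e, b), Sum.inr (e', b') => b = false ∧ b' = true ∧ e = e'
  | _, _ => False

/-- A simple directed path from `s` to `t`, given by its list of vertices. -/
def IsDiPath {W : Type*} (A : W → W → Prop) (s t : W) (l : List W) : Prop :=
  l.Nodup ∧ l.Chain' A ∧ l.head? = some s ∧ l.getLast? = some t

/-- The vertex list of the directed walk that runs through the gadgets of the edges of `p`. -/
def gadgetList {V : Type*} {G : SimpleGraph V} : {u v : V} → G.Walk u v → List (DV V G)
  | u, _, .nil => [Sum.inl u]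
  | u, _, .cons (v := w) h p =>
      Sum.inl u :: Sum.inr (⟨s(u, w), h⟩, false) :: Sum.inr (⟨s(u, w), h⟩, true) :: gadgetList p

section gadgetList

variable {V : Type*} {G : SimpleGraph V} {u v : V}

lemma inl_mem_gadgetList (p : G.Walk u v) (x : V) :
    Sum.inl x ∈ gadgetList p ↔ x ∈ p.support := by
  induction p with
  | nil => simp [gadgetList]
  | cons h p ih => simp [gadgetList, ih]

lemma inr_mem_gadgetList (p : G.Walk u v) (e : G.edgeSet) (b : Bool) :
    Sum.inr (e, b) ∈ gadgetList p ↔ (e : Sym2 V) ∈ p.edges := by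
  induction p with
  | nil => simp [gadgetList]
  | cons h p ih => cases b <;> simp [gadgetList, ih, Subtype.ext_iff]

lemma exists_gadgetList_eq_cons (p : G.Walk u v) : ∃ l, gadgetList p = Sum.inl u :: l := by
  cases p <;> simp [gadgetList]

lemma head?_gadgetList (p : G.Walk u v) : (gadgetList p).head? = some (Sum.inl u) := by
  obtain ⟨l, hl⟩ := exists_gadgetList_eq_cons p
  simp [hl]

lemma getLast?_gadgetList (p : G.Walk u v) : (gadgetList p).getLast? = some (Sum.inl v) := by
  induction p with
  | nil => simp [gadgetList]
  | cons h p ih => simp [gadgetList, List.getLast?_cons, ih]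

lemma isChain_gadgetList (p : G.Walk u v) : (gadgetList p).IsChain (A G) := by
  induction p with
  | nil => simp [gadgetList]
  | cons h p ih =>
    obtain ⟨l, hl⟩ := exists_gadgetList_eq_cons p
    rw [hl] at ih
    simp [gadgetList, hl, ih, A]

lemma nodup_gadgetList_iff (p : G.Walk u v) : (gadgetList p).Nodup ↔ p.IsPath := by
  induction p with
  | nil => simp [gadgetList]
  | cons h p ih =>
    simp only [gadgetList, List.nodup_cons, List.mem_cons, inl_mem_gadgetList,
      inr_mem_gadgetList, ih, SimpleGraph.Walk.cons_isPath_iff]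
    constructor
    · rintro ⟨hu, -, -, hp⟩
      exact ⟨hp, fun hm => hu (Or.inr (Or.inr hm))⟩
    · rintro ⟨hp, hu⟩
      have he := fun w (hm : s(_, w) ∈ p.edges) => hu (p.fst_mem_support_of_mem_edges hm)
      simp_all

lemma isDiPath_gadgetList {p : G.Walk u v} (hp : p.IsPath) :
    IsDiPath (A G) (Sum.inl u) (Sum.inl v) (gadgetList p) :=
  ⟨(nodup_gadgetList_iff p).2 hp, isChain_gadgetList p, head?_gadgetList p,
    getLast?_gadgetList p⟩

lemma gadgetList_injective :
    Function.Injective (gadgetList : G.Walk u v → List (DV V G)) := by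
  intro p q hpq
  induction p with
  | nil =>
    cases q with
    | nil => rfl
    | cons h q => simp [gadgetList] at hpq
  | cons h p ih =>
    cases q with
    | nil => simp [gadgetList] at hpq
    | cons h' q =>
      simp only [gadgetList, List.cons.injEq] at hpq
      have hhead := congrArg List.head? hpq.2.2.2
      simp only [head?_gadgetList, Option.some.injEq, Sum.inl.injEq] at hhead
      subst hhead
      rw [ih hpq.2.2.2]

lemma exists_gadgetList_eq (l : List (DV V G)) (u : V)
    (hl : IsDiPath (A G) (Sum.inl u) (Sum.inl v) l) : ∃ p : G.Walk u v, gadgetList p = l := by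
  match l, hl with
  | [], ⟨_, _, hhd, _⟩ => simp at hhd
  | [x], ⟨_, _, hhd, hlast⟩ =>
    simp only [List.head?_cons, Option.some.injEq] at hhd
    subst hhd
    simp only [List.getLast?_singleton, Option.some.injEq, Sum.inl.injEq] at hlast
    subst hlast
    exact ⟨.nil, rfl⟩
  | [x, y], ⟨_, hch, hhd, hlast⟩ =>
    change List.IsChain _ _ at hch
    simp only [List.head?_cons, Option.some.injEq] at hhd
    subst hhd
    simp only [List.getLast?_cons_cons, List.getLast?_singleton, Option.some.injEq] at hlast
    subst hlast
    simp [A] at hch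
  | [x, y, z], ⟨_, hch, hhd, hlast⟩ =>
    change List.IsChain _ _ at hch
    simp only [List.head?_cons, Option.some.injEq] at hhd
    subst hhd
    simp only [List.getLast?_cons_cons, List.getLast?_singleton, Option.some.injEq] at hlast
    subst hlast
    rcases y with y | ⟨e, b⟩ <;> simp [A] at hch
    simp [hch.1.1] at hch
  | x :: y :: z :: a :: l, ⟨hnd, hch, hhd, hlast⟩ =>
    change List.IsChain _ _ at hch
    simp only [List.head?_cons, Option.some.injEq] at hhd
    subst hhd
    rcases y with y | ⟨e, b⟩
    · simp [A] at hch
    rcases z with z | ⟨e', b'⟩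
    · simp only [A, List.isChain_cons_cons] at hch
      simp [hch.1.1] at hch
    rcases a with w | ⟨e'', b''⟩
    · simp only [A, List.isChain_cons_cons] at hch
      obtain ⟨⟨rfl, hu⟩, ⟨-, rfl, rfl⟩, ⟨-, hw⟩, hch⟩ := hch
      have hne : u ≠ w := by
        rintro rfl
        simp at hnd
      obtain ⟨p, hp⟩ := exists_gadgetList_eq (Sum.inl w :: l) w
        ⟨by simp only [List.nodup_cons] at hnd ⊢; exact hnd.2.2.2, hch, rfl, by simpa using hlast⟩
      obtain ⟨e, he⟩ := e
      obtain rfl := (Sym2.mem_and_mem_iff hne).1 ⟨hu, hw⟩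
      exact ⟨.cons he p, by simp [gadgetList, hp]⟩
    · simp only [A, List.isChain_cons_cons] at hch
      simp [hch.2.1.2.1] at hch
termination_by l.length

lemma mem_zip_tail_gadgetList_iff (p : G.Walk u v) (e : G.edgeSet) :
    ((Sum.inr (e, false) : DV V G), (Sum.inr (e, true) : DV V G)) ∈
      (gadgetList p).zip (gadgetList p).tail ↔ (e : Sym2 V) ∈ p.edges := by
  induction p with
  | nil => simp [gadgetList]
  | cons h p ih =>
    obtain ⟨l, hl⟩ := exists_gadgetList_eq_cons p
    simp only [hl, List.tail_cons] at ih
    simp [gadgetList, hl, ih, Subtype.ext_iff]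

end gadgetList

/-- Bijection between simple s-t-paths of the undirected graph `G` and simple directed
s-t-paths of the gadget digraph, under which an edge `e` of the undirected path
corresponds to the middle edge `(w_e, w'_e)` of the directed path. -/
theorem stmt_15 {V : Type*} [DecidableEq V] (G : SimpleGraph V) (s t : V) :
    ∃ f : {p : G.Walk s t // p.IsPath} ≃
          {l : List (DV V G) // IsDiPath (A G) (Sum.inl s) (Sum.inl t) l},
      ∀ (p : {p : G.Walk s t // p.IsPath}) (e : G.edgeSet),
        (e : Sym2 V) ∈ p.1.edges ↔
          ((Sum.inr (e, false) : DV V G), (Sum.inr (e, true) : DV V G)) ∈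
            (f p).1.zip (f p).1.tail := by
  refine ⟨Equiv.ofBijective (fun p => ⟨gadgetList p.1, isDiPath_gadgetList p.2⟩) ⟨?_, ?_⟩, ?_⟩
  · intro p q hpq
    exact Subtype.ext (gadgetList_injective (congrArg Subtype.val hpq))
  · rintro ⟨l, hl⟩
    obtain ⟨p, rfl⟩ := exists_gadgetList_eq l s hl
    exact ⟨⟨p, (nodup_gadgetList_iff p).1 hl.1⟩, rfl⟩
  · intro p e
    exact (mem_zip_tail_gadgetList_iff p.1 e).symm

end Stmt15
end

section
/- Let G = (V, E) be a finite undirected graph and W ⊆ V. Suppose for each w ∈ W the path gadget P_w = {{w₁,w₂},{w₂,w₃}} is constructed as in the vertex fixing construction, and suppose the leader's choice X' includes both edges of P_w for every w ∈ W, while all edges of P_w are leader's edges. Then every simple s'-t'-path P' in the modified graph that contains X' must contain each P_w as a subpath, cannot use any dangerous edge of Ẽ = ∪_{w∈W} {{w₂,t},{w₂,t'}}, and must end with the edge {t, t'}; consequently its contraction τ(P') is an s-t-path in G whose vertex set includes W. -/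
namespace Stmt16

/-- Vertices of the modified graph: the original vertices, plus for each vertex `w` the
gadget vertices `w₁ = (w,0)`, `w₂ = (w,1)`, `w₃ = (w,2)`, plus the new sink `t'`. -/
abbrev MV (V : Type*) := V ⊕ ((V × Fin 3) ⊕ Unit)

/-- The new sink `t'`. -/
def tP (V : Type*) : MV V := Sum.inr (Sum.inr ())

/-- Relation generating the modified graph: vertices `w ∈ W` are replaced by the path
`w₁–w₂–w₃`, edges of `G` incident to `w ∈ W` are duplicated to attach to `w₁` and `w₃`,
and we add the edge `{t,t'}` and the dangerous edges `{w₂,t}`, `{w₂,t'}` for `w ∈ W`. -/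
def rel {V : Type*} [DecidableEq V] (G : SimpleGraph V) (W : Finset V) (t : V) :
    MV V → MV V → Prop := fun x y =>
  match x, y with
  | Sum.inl a, Sum.inl b => a ∉ W ∧ b ∉ W ∧ G.Adj a b
  | Sum.inl a, Sum.inr (Sum.inl (w, i)) =>
      a ∉ W ∧ w ∈ W ∧ G.Adj a w ∧ (i = 0 ∨ i = 2)
  | Sum.inr (Sum.inl (w, i)), Sum.inr (Sum.inl (w', j)) =>
      (w = w' ∧ w ∈ W ∧ ((i = 0 ∧ j = 1) ∨ (i = 1 ∧ j = 2))) ∨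
      (w ∈ W ∧ w' ∈ W ∧ G.Adj w w' ∧ (i = 0 ∨ i = 2) ∧ (j = 0 ∨ j = 2))
  | Sum.inr (Sum.inl (w, i)), Sum.inl b => w ∈ W ∧ i = 1 ∧ b = t   -- dangerous {w₂, t}
  | Sum.inr (Sum.inl (w, i)), Sum.inr (Sum.inr _) => w ∈ W ∧ i = 1 -- dangerous {w₂, t'}
  | Sum.inl a, Sum.inr (Sum.inr _) => a = t                        -- the edge {t, t'}
  | _, _ => False

/-- The modified (undirected) graph. -/
def modGraph {V : Type*} [DecidableEq V] (G : SimpleGraph V) (W : Finset V) (t : V) :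
    SimpleGraph (MV V) := SimpleGraph.fromRel (rel G W t)

/-- The first gadget edge `{w₁, w₂}` of `P_w`. -/
def gE1 {V : Type*} (w : V) : Sym2 (MV V) :=
  s(Sum.inr (Sum.inl (w, 0)), Sum.inr (Sum.inl (w, 1)))

/-- The second gadget edge `{w₂, w₃}` of `P_w`. -/
def gE2 {V : Type*} (w : V) : Sym2 (MV V) :=
  s(Sum.inr (Sum.inl (w, 1)), Sum.inr (Sum.inl (w, 2)))

/-- The contraction map: gadget vertices `wᵢ` go to `w`, and the new sink `t'` goes to `t`. -/
def contract {V : Type*} (t : V) : MV V → V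
  | Sum.inl a => a
  | Sum.inr (Sum.inl (w, _)) => w
  | Sum.inr (Sum.inr _) => t

/-- Every edge of a walk joins two consecutive vertices of the walk. -/
theorem exists_getVert_of_mem_edges {α : Type*} {H : SimpleGraph α} {x y : α} (p : H.Walk x y)
    {e : Sym2 α} (he : e ∈ p.edges) :
    ∃ i < p.length, e = s(p.getVert i, p.getVert (i + 1)) := by
  induction p with
  | nil => simp at he
  | cons h p ih =>
    rw [SimpleGraph.Walk.edges_cons, List.mem_cons] at he
    rcases he with rfl | he
    · exact ⟨0, by simp, by simp⟩
    · obtain ⟨i, hi, rfl⟩ := ih he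
      exact ⟨i + 1, by simpa using hi, by simp⟩

/-- Consecutive vertices of a walk are joined by an edge of the walk. -/
theorem getVert_mem_edges {α : Type*} {H : SimpleGraph α} {x y : α} (p : H.Walk x y)
    {i : ℕ} (hi : i < p.length) : s(p.getVert i, p.getVert (i + 1)) ∈ p.edges := by
  induction p generalizing i with
  | nil => simp at hi
  | cons h p ih =>
    cases i with
    | zero => simp
    | succ i =>
      rw [SimpleGraph.Walk.edges_cons, List.mem_cons]
      exact Or.inr (by simpa using ih (by simpa using hi))

/-- A walk whose vertices, under a map `f`, are equal or adjacent at consecutive positions and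
whose fibres of `f` are contiguous is mapped by `f` to a path with the same set of vertices. -/
theorem exists_isPath_of_contiguous {α β : Type*} {H : SimpleGraph α} {G : SimpleGraph β}
    (f : α → β) {x y : α} (p : H.Walk x y)
    (hadj : ∀ i < p.length, f (p.getVert i) = f (p.getVert (i + 1)) ∨
      G.Adj (f (p.getVert i)) (f (p.getVert (i + 1))))
    (hcont : ∀ i j, i < j → j ≤ p.length → f (p.getVert i) = f (p.getVert j) →
      f (p.getVert i) = f (p.getVert (i + 1))) :
    ∃ q : G.Walk (f x) (f y), q.IsPath ∧ ∀ v, v ∈ q.support ↔ ∃ z ∈ p.support, f z = v := by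
  induction p with
  | nil => exact ⟨.nil, by simp, by simp [eq_comm]⟩
  | @cons a b c h p ih =>
    obtain ⟨q, hq, hsupp⟩ := ih
      (fun i hi => by simpa using hadj (i + 1) (by simpa using hi))
      (fun i j hij hj hf => by
        simpa using hcont (i + 1) (j + 1) (by omega) (by simpa using hj) (by simpa using hf))
    by_cases hab : f a = f b
    · refine ⟨q.copy hab.symm rfl, by simpa using hq, fun v => ?_⟩
      simp only [SimpleGraph.Walk.support_copy, hsupp, SimpleGraph.Walk.support_cons,
        List.mem_cons, exists_eq_or_imp]
      refine ⟨Or.inr, ?_⟩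
      rintro (rfl | hv)
      · exact ⟨b, p.start_mem_support, hab.symm⟩
      · exact hv
    · have hG : G.Adj (f a) (f b) := by
        have := hadj 0 (by simp)
        simp only [SimpleGraph.Walk.getVert_zero, SimpleGraph.Walk.getVert_cons_succ] at this
        exact this.resolve_left hab
      refine ⟨.cons hG q, hq.cons ?_, fun v => ?_⟩
      · rw [hsupp]
        rintro ⟨z, hz, hza⟩
        obtain ⟨j, rfl, hj⟩ := SimpleGraph.Walk.mem_support_iff_exists_getVert.mp hz
        have := hcont 0 (j + 1) (by omega) (by simpa using hj) (by simpa using hza.symm)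
        exact hab (by simpa using this)
      · simp [hsupp, eq_comm]

/-- In a path with both edges of `P_w`, the vertices `w₁, w₂, w₃` are consecutive, in this or in
the reverse order. -/
theorem exists_gadget_position {V : Type*} {H : SimpleGraph (MV V)} {x y : MV V}
    {p : H.Walk x y} (hp : p.IsPath) {w : V} (h₁ : gE1 w ∈ p.edges) (h₂ : gE2 w ∈ p.edges) :
    ∃ m, m + 2 ≤ p.length ∧ p.getVert (m + 1) = Sum.inr (Sum.inl (w, 1)) ∧
      ((p.getVert m = Sum.inr (Sum.inl (w, 0)) ∧ p.getVert (m + 2) = Sum.inr (Sum.inl (w, 2))) ∨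
       (p.getVert m = Sum.inr (Sum.inl (w, 2)) ∧
          p.getVert (m + 2) = Sum.inr (Sum.inl (w, 0)))) := by
  have inj : ∀ i j, i ≤ p.length → j ≤ p.length → p.getVert i = p.getVert j → i = j :=
    fun i j hi hj h => hp.getVert_injOn hi hj h
  obtain ⟨i, hi, hi'⟩ := exists_getVert_of_mem_edges p h₁
  obtain ⟨j, hj, hj'⟩ := exists_getVert_of_mem_edges p h₂
  simp only [gE1, gE2, Sym2.eq_iff] at hi' hj'
  rcases hi' with ⟨a, b⟩ | ⟨a, b⟩ <;> rcases hj' with ⟨c, d⟩ | ⟨c, d⟩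
  · obtain rfl := inj (i + 1) j (by omega) (by omega) (b.symm.trans c)
    exact ⟨i, by omega, b.symm, Or.inl ⟨a.symm, d.symm⟩⟩
  · have := inj (i + 1) (j + 1) (by omega) (by omega) (b.symm.trans c)
    obtain rfl : i = j := by omega
    simpa using a.trans d.symm
  · obtain rfl := inj i j (by omega) (by omega) (b.symm.trans c)
    simpa using a.trans d.symm
  · obtain rfl := inj i (j + 1) (by omega) (by omega) (b.symm.trans c)
    exact ⟨j, by omega, b.symm, Or.inr ⟨d.symm, a.symm⟩⟩

/-- In a path with both edges of `P_w`, a gadget vertex of `w` that is not the last one on the path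
is followed by another gadget vertex of `w`. -/
theorem contract_getVert_succ_of_gadget {V : Type*} {H : SimpleGraph (MV V)} {x y : MV V}
    {p : H.Walk x y} (hp : p.IsPath) (t : V) {w : V} (h₁ : gE1 w ∈ p.edges) (h₂ : gE2 w ∈ p.edges)
    {k l : ℕ} (hkl : k < l) (hl : l ≤ p.length) {a b : Fin 3}
    (ha : p.getVert k = Sum.inr (Sum.inl (w, a))) (hb : p.getVert l = Sum.inr (Sum.inl (w, b))) :
    contract t (p.getVert k) = contract t (p.getVert (k + 1)) := by
  obtain ⟨m, hm, hmid, hends⟩ := exists_gadget_position hp h₁ h₂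
  have near : ∀ k ≤ p.length, ∀ a, p.getVert k = Sum.inr (Sum.inl (w, a)) →
      k = m ∨ k = m + 1 ∨ k = m + 2 := by
    intro k hk a ha
    have h₀ : p.getVert k = p.getVert m → k = m :=
      hp.getVert_injOn hk (show m ≤ p.length by omega)
    have h₁ : p.getVert k = p.getVert (m + 1) → k = m + 1 :=
      hp.getVert_injOn hk (show m + 1 ≤ p.length by omega)
    have h₂ : p.getVert k = p.getVert (m + 2) → k = m + 2 := hp.getVert_injOn hk hm
    rw [ha] at h₀ h₁ h₂
    fin_cases a <;> grind
  have hl' := near l hl b hb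
  rcases near k (by omega) a ha with rfl | rfl | rfl
  · rw [ha, hmid]; rfl
  · rcases hends with ⟨_, h⟩ | ⟨_, h⟩ <;> rw [ha, h] <;> rfl
  · omega

/-- Edges of the modified graph other than the dangerous ones contract to a vertex or to an edge
of `G`. -/
theorem contract_eq_or_adj {V : Type*} [DecidableEq V] {G : SimpleGraph V} {W : Finset V} {t : V}
    {x y : MV V} (h : (modGraph G W t).Adj x y)
    (hsafe : ∀ w ∈ W, s(x, y) ≠ s(Sum.inr (Sum.inl (w, 1)), Sum.inl t) ∧
      s(x, y) ≠ s(Sum.inr (Sum.inl (w, 1)), tP V)) :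
    contract t x = contract t y ∨ G.Adj (contract t x) (contract t y) := by
  have key : ∀ x y : MV V, rel G W t x y →
      (∀ w ∈ W, s(x, y) ≠ s(Sum.inr (Sum.inl (w, 1)), Sum.inl t) ∧
        s(x, y) ≠ s(Sum.inr (Sum.inl (w, 1)), tP V)) →
      contract t x = contract t y ∨ G.Adj (contract t x) (contract t y) := by
    rintro (a | ⟨w, i⟩ | _) (b | ⟨w', j⟩ | _) h hsafe <;> simp only [rel] at h
    · exact Or.inr h.2.2
    · exact Or.inr h.2.2.1
    · exact Or.inl h
    · obtain ⟨hw, rfl, rfl⟩ := h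
      exact absurd rfl (hsafe w hw).1
    · rcases h with h | h
      · exact Or.inl h.1
      · exact Or.inr h.2.2.1
    · obtain ⟨hw, rfl⟩ := h
      exact absurd rfl (hsafe w hw).2
  rcases ((SimpleGraph.fromRel_adj _ _ _).mp h).2 with h | h
  · exact key x y h hsafe
  · exact (key y x h (by simpa only [Sym2.eq_swap] using hsafe)).imp Eq.symm SimpleGraph.Adj.symm

/-- The neighbours of `t'` are `t` and the middle vertices `w₂`. -/
theorem eq_of_adj_tP {V : Type*} [DecidableEq V] {G : SimpleGraph V} {W : Finset V} {t : V}
    {x : MV V} (h : (modGraph G W t).Adj x (tP V)) :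
    x = Sum.inl t ∨ ∃ w ∈ W, x = Sum.inr (Sum.inl (w, 1)) := by
  rcases ((SimpleGraph.fromRel_adj _ _ _).mp h).2 with h | h <;>
    rcases x with a | ⟨w, i⟩ | _ <;> simp_all [rel, tP]

/-- Gadget vertices of vertices outside `W`, and original vertices in `W`, are isolated. -/
theorem mem_of_adj {V : Type*} [DecidableEq V] {G : SimpleGraph V} {W : Finset V} {t : V}
    (ht : t ∉ W) {x y : MV V} (h : (modGraph G W t).Adj x y) :
    (∀ a, x = Sum.inl a → a ∉ W) ∧ (∀ w i, x = Sum.inr (Sum.inl (w, i)) → w ∈ W) := by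
  rcases ((SimpleGraph.fromRel_adj _ _ _).mp h).2 with h | h <;>
    rcases x with a | ⟨w, i⟩ | _ <;> rcases y with b | ⟨w', j⟩ | _ <;>
    simp only [rel] at h <;> grind

/-- Core claim of the vertex fixing lemma: if a simple `s'`-`t'`-path `P'` in the
modified graph contains both edges of every gadget path `P_w`, `w ∈ W`, then the only
edges of `P'` at each `w₂` are the two edges of `P_w` (so each `P_w` is a subpath),
`P'` uses no dangerous edge, it uses the edge `{t,t'}`, and its contraction yields a
simple `s`-`t`-path in `G` whose vertex set includes `W`. -/
theorem stmt_16 {V : Type*} [DecidableEq V] (G : SimpleGraph V) (W : Finset V)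
    (s t : V) (hs : s ∉ W) (ht : t ∉ W) (hst : s ≠ t)
    (P' : (modGraph G W t).Walk (Sum.inl s) (tP V)) (hP' : P'.IsPath)
    (hX : ∀ w ∈ W, gE1 w ∈ P'.edges ∧ gE2 w ∈ P'.edges) :
    (∀ w ∈ W, ∀ e ∈ P'.edges,
      (Sum.inr (Sum.inl (w, 1)) : MV V) ∈ e → e = gE1 w ∨ e = gE2 w) ∧
    (∀ w ∈ W,
      s((Sum.inr (Sum.inl (w, 1)) : MV V), Sum.inl t) ∉ P'.edges ∧
      s((Sum.inr (Sum.inl (w, 1)) : MV V), tP V) ∉ P'.edges) ∧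
    (s((Sum.inl t : MV V), tP V) ∈ P'.edges) ∧
    (∃ q : G.Walk s t, q.IsPath ∧ ∀ w ∈ W, w ∈ q.support) := by
  have inj : ∀ i j, i ≤ P'.length → j ≤ P'.length → P'.getVert i = P'.getVert j → i = j :=
    fun i j hi hj h => hP'.getVert_injOn hi hj h
  have pos := fun w hw => exists_gadget_position hP' (hX w hw).1 (hX w hw).2
  have incident : ∀ w ∈ W, ∀ e ∈ P'.edges,
      (Sum.inr (Sum.inl (w, 1)) : MV V) ∈ e → e = gE1 w ∨ e = gE2 w := by
    intro w hw e he hwe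
    obtain ⟨m, hm, hmid, hends⟩ := pos w hw
    obtain ⟨i, hi, rfl⟩ := exists_getVert_of_mem_edges P' he
    rw [Sym2.mem_iff, ← hmid] at hwe
    rcases hwe with h | h
    · obtain rfl := inj _ _ (by omega) (by omega) h
      rcases hends with ⟨_, h₂⟩ | ⟨_, h₂⟩ <;> simp [hmid, h₂, gE1, gE2]
    · have := inj _ _ (by omega) (by omega) h
      obtain rfl : m = i := by omega
      rcases hends with ⟨h₀, _⟩ | ⟨h₀, _⟩ <;> simp [hmid, h₀, gE1, gE2]
  have safe : ∀ w ∈ W,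
      s((Sum.inr (Sum.inl (w, 1)) : MV V), Sum.inl t) ∉ P'.edges ∧
      s((Sum.inr (Sum.inl (w, 1)) : MV V), tP V) ∉ P'.edges := by
    refine fun w hw => ⟨fun h => ?_, fun h => ?_⟩ <;>
      simpa [gE1, gE2, tP] using incident w hw _ h (Sym2.mem_mk_left _ _)
  have hlen : 0 < P'.length := by
    rcases Nat.eq_zero_or_pos P'.length with h | h
    · simpa [tP] using SimpleGraph.Walk.eq_of_length_eq_zero h
    · exact h
  obtain ⟨n, hn⟩ : ∃ n, P'.length = n + 1 := ⟨P'.length - 1, by omega⟩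
  have hend : P'.getVert (n + 1) = tP V := by rw [← hn, P'.getVert_length]
  have hlast : s(P'.getVert n, tP V) ∈ P'.edges := by
    have := getVert_mem_edges P' (show n < P'.length by omega)
    rwa [hend] at this
  have hpen : P'.getVert n = Sum.inl t := by
    rcases eq_of_adj_tP (P'.adj_of_mem_edges hlast) with h | ⟨w, hw, h⟩
    · exact h
    · rw [h] at hlast
      exact absurd hlast (safe w hw).2
  refine ⟨incident, safe, hpen ▸ hlast, ?_⟩
  have hcont : ∀ i j, i < j → j ≤ P'.length →
      contract t (P'.getVert i) = contract t (P'.getVert j) →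
      contract t (P'.getVert i) = contract t (P'.getVert (i + 1)) := by
    intro i j hij hj hf
    have hi := mem_of_adj ht (P'.adj_getVert_succ (show i < P'.length by omega))
    have hj' : P'.getVert j = tP V ∨ (∀ a, P'.getVert j = Sum.inl a → a ∉ W) ∧
        (∀ w b, P'.getVert j = Sum.inr (Sum.inl (w, b)) → w ∈ W) := by
      rcases hj.lt_or_eq with h | rfl
      · exact Or.inr (mem_of_adj ht (P'.adj_getVert_succ h))
      · exact Or.inl P'.getVert_length
    have hne : P'.getVert i ≠ P'.getVert j := fun h => by
      have := inj i j (by omega) hj h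
      omega
    rcases hgi : P'.getVert i with a | ⟨w, k⟩ | u
    · rcases hgj : P'.getVert j with b | ⟨w', l⟩ | u
      · obtain rfl : a = b := by simpa [hgi, hgj, contract] using hf
        exact absurd (hgi.trans hgj.symm) hne
      · obtain rfl : a = w' := by simpa [hgi, hgj, contract] using hf
        rcases hj' with h | h
        · simpa [tP] using hgj.symm.trans h
        · exact absurd (h.2 a l hgj) (hi.1 a hgi)
      · obtain rfl : a = t := by simpa [hgi, hgj, contract] using hf
        obtain rfl := inj i n (by omega) (by omega) (hgi.trans hpen.symm)
        rw [hend]; rfl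
    · have hw := hi.2 w k hgi
      rw [← hgi]
      rcases hgj : P'.getVert j with b | ⟨w', l⟩ | u
      · obtain rfl : w = b := by simpa [hgi, hgj, contract] using hf
        rcases hj' with h | h
        · simpa [tP] using hgj.symm.trans h
        · exact absurd hw (h.1 w hgj)
      · obtain rfl : w = w' := by simpa [hgi, hgj, contract] using hf
        exact contract_getVert_succ_of_gadget hP' t (hX w hw).1 (hX w hw).2 hij hj hgi hgj
      · obtain rfl : w = t := by simpa [hgi, hgj, contract] using hf
        exact absurd hw ht
    · have := inj i (n + 1) (by omega) (by omega) (hgi.trans hend.symm)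
      omega
  obtain ⟨q, hq, hsupp⟩ := exists_isPath_of_contiguous (G := G) (contract t) P'
    (fun i hi => contract_eq_or_adj (P'.adj_getVert_succ hi) fun w hw =>
      ⟨fun h => (safe w hw).1 (h ▸ getVert_mem_edges P' hi),
        fun h => (safe w hw).2 (h ▸ getVert_mem_edges P' hi)⟩) hcont
  refine ⟨q, hq, fun w hw => (hsupp w).mpr ?_⟩
  obtain ⟨m, _, hmid, _⟩ := pos w hw
  exact ⟨_, P'.getVert_mem_support (m + 1), by rw [hmid]; rfl⟩

end Stmt16
end
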